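/- Let m_1 = 2·m_2 with m_2 odd, let a ∈ F_{2^{m_1}}^*, let γ ∈ F_4^* ⊆ F_{2^{m_1}}^*, and set α = χ_{m_1}(a). Then 3 · ∑_{x ∈ F_{2^{m_1}}^*, χ_{m_1}(x) = γ} (−1)^{Tr^{m_1}(a·x + x^{−1})} = 2·C_{m_1}(a,a) + K_{m_1}(a) − 1 if γ = α, and 3 · ∑_{x ∈ F_{2^{m_1}}^*, χ_{m_1}(x) = γ} (−1)^{Tr^{m_1}(a·x + x^{−1})} = −C_{m_1}(a,a) + K_{m_1}(a) − 1 if γ ≠ α. -/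

import Mathlib

open Finset

attribute [local instance] Classical.propDecidable

noncomputable section

/-- The absolute trace `Tr^k` of `GF(2^k)`, as a function on an ambient field of
characteristic two containing `GF(2^k)`. -/
def absTr {F : Type*} [Field F] (k : ℕ) (x : F) : F :=
  ∑ i ∈ Finset.range k, x ^ 2 ^ i

/-- The relative field trace `Tr^k_j` from `GF(2^k)` to `GF(2^j)`. -/
def relTr {F : Type*} [Field F] (k j : ℕ) (x : F) : F :=
  ∑ i ∈ Finset.range (k / j), x ^ 2 ^ (j * i)

/-- `(-1)^b` for `b ∈ F_2`, viewed inside an ambient field of characteristic two. -/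
def sgn {F : Type*} [Field F] (b : F) : ℤ := if b = 0 then 1 else -1

/-- The subfield `GF(2^k)` of the ambient field, as a finset. -/
def gf (F : Type*) [Field F] [Fintype F] (k : ℕ) : Finset F :=
  Finset.univ.filter fun x => x ^ 2 ^ k = x

/-- The trace of `F_4` down to `F_2`, `tr_2(y) = y + y²`. -/
def tr2 {F : Type*} [Field F] (y : F) : F := y + y ^ 2

/-- The cubic multiplicative character `χ_k(x) = x^((2^k-1)/3)` of `GF(2^k)`. -/
def chi {F : Type*} [Field F] (k : ℕ) (x : F) : F := x ^ ((2 ^ k - 1) / 3)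

/-- The Walsh transform at `ω` of a Boolean function on `GF(2^n)`
(with values in `F_2` inside the ambient field). -/
def walsh {F : Type*} [Field F] [Fintype F] (n : ℕ) (f : F → F) (ω : F) : ℤ :=
  ∑ x : F, sgn (f x + absTr n (ω * x))

/-- The binary Kloosterman sum `K_k(a)` (with the convention `0⁻¹ = 0`). -/
def kloo {F : Type*} [Field F] [Fintype F] (k : ℕ) (a : F) : ℤ :=
  ∑ x ∈ gf F k, sgn (absTr k (a * x + x⁻¹))

/-- The binary cubic sum `C_k(a,b)`. -/
def cub {F : Type*} [Field F] [Fintype F] (k : ℕ) (a b : F) : ℤ :=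
  ∑ x ∈ gf F k, sgn (absTr k (a * x ^ 3 + b * x))

/-- `f_a(x) = Tr^n(a · x^(2^{m₁}-1))`. -/
def fA {F : Type*} [Field F] (n m1 : ℕ) (a x : F) : F :=
  absTr n (a * x ^ (2 ^ m1 - 1))

/-- `g_b(x) = tr_2(b · χ_n(x))`. -/
def gB {F : Type*} [Field F] (n : ℕ) (b x : F) : F := tr2 (b * chi n x)

/-- The binomial Boolean function `f_{a,b} = f_a + g_b`. -/
def fAB {F : Type*} [Field F] (n m1 : ℕ) (a b x : F) : F :=
  fA n m1 a x + gB n b x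

/-- `U`, the image of `U_1 × ⋯ × U_ν` in `GF(2^n)^*` under multiplication, where
`U_i` is the subgroup of `(2^{m_i}+1)`-th roots of unity and `m_i = 2^{ν-i}·m`. -/
def bigU (F : Type*) [Field F] [Fintype F] (ν m : ℕ) : Finset F :=
  Finset.univ.filter fun u => ∃ c : Fin ν → F,
    (∀ i : Fin ν, c i ^ (2 ^ (2 ^ (ν - 1 - (i : ℕ)) * m) + 1) = 1) ∧ u = ∏ i, c i

section TraceSign

variable {F : Type*} [Field F]

theorem absTr_add [CharP F 2] (m : ℕ) (x y : F) :
    absTr m (x + y) = absTr m x + absTr m y := by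
  have : Fact (Nat.Prime 2) := ⟨Nat.prime_two⟩
  simp [absTr, add_pow_char_pow, Finset.sum_add_distrib]

theorem absTr_one_of_even [CharP F 2] {m : ℕ} (hm : Even m) : absTr m (1 : F) = 0 := by
  simpa [absTr] using (CharP.cast_eq_zero_iff F 2 m).2 hm.two_dvd

variable [Fintype F]

theorem charP_two_of_card {m : ℕ} (hF : Fintype.card F = 2 ^ m) : CharP F 2 := by
  have : Fact (Nat.Prime 2) := ⟨Nat.prime_two⟩
  exact charP_of_card_eq_prime_pow hF

theorem absTr_pow_two {m : ℕ} (hF : Fintype.card F = 2 ^ m) (x : F) :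
    absTr m (x ^ 2) = absTr m x := by
  have h1 := Finset.sum_range_succ (fun i => x ^ 2 ^ i) m
  have h2 := Finset.sum_range_succ' (fun i => x ^ 2 ^ i) m
  have h3 : x ^ 2 ^ m = x := hF ▸ FiniteField.pow_card x
  have h4 : absTr m (x ^ 2) = ∑ i ∈ Finset.range m, x ^ 2 ^ (i + 1) :=
    Finset.sum_congr rfl fun i _ => by rw [← pow_mul, pow_succ' 2 i]
  rw [h4]
  simp only [h3, pow_zero, pow_one] at h1 h2
  exact add_right_cancel (h2.symm.trans h1)

theorem absTr_eq_zero_or_one {m : ℕ} (hF : Fintype.card F = 2 ^ m) (x : F) :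
    absTr m x = 0 ∨ absTr m x = 1 := by
  have : CharP F 2 := charP_two_of_card hF
  have : Fact (Nat.Prime 2) := ⟨Nat.prime_two⟩
  have h : absTr m (x ^ 2) = absTr m x ^ 2 := by
    rw [absTr, absTr, sum_pow_char]
    exact Finset.sum_congr rfl fun i _ => by rw [← pow_mul, ← pow_mul, mul_comm]
  rw [absTr_pow_two hF] at h
  have h0 : absTr m x * (absTr m x - 1) = 0 := by linear_combination -h
  rcases mul_eq_zero.1 h0 with h0 | h0
  · exact Or.inl h0
  · exact Or.inr (sub_eq_zero.1 h0)

theorem exists_absTr_eq_one {m : ℕ} (hF : Fintype.card F = 2 ^ m) :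
    ∃ e : F, absTr m e = 1 := by
  by_contra! hne
  have hz : ∀ x : F, absTr m x = 0 := fun x =>
    (absTr_eq_zero_or_one hF x).resolve_right (hne x)
  have hm : 0 < m := by
    rcases Nat.eq_zero_or_pos m with rfl | h
    · exact absurd hF (by simpa using (Fintype.one_lt_card (α := F)).ne')
    · exact h
  let p : Polynomial F := ∑ i ∈ Finset.range m, Polynomial.X ^ 2 ^ i
  have hdeg : p.natDegree ≤ 2 ^ (m - 1) := by
    refine Polynomial.natDegree_sum_le_of_forall_le _ _ fun i hi => ?_
    rw [Polynomial.natDegree_X_pow]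
    exact Nat.pow_le_pow_right two_pos (by have := Finset.mem_range.1 hi; omega)
  have hp : p = 0 := by
    refine Polynomial.eq_zero_of_natDegree_lt_card_of_eval_eq_zero p
      (f := (id : F → F)) Function.injective_id (fun x => ?_) ?_
    · simpa [p, Polynomial.eval_finsetSum, absTr] using hz x
    · rw [hF]
      exact hdeg.trans_lt (Nat.pow_lt_pow_right one_lt_two (by omega))
  have hc : p.coeff 1 = 1 := by
    simp only [p, Polynomial.finsetSum_coeff, Polynomial.coeff_X_pow]
    rw [Finset.sum_eq_single_of_mem 0 (Finset.mem_range.2 hm)]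
    · simp
    · intro i _ hi
      exact if_neg (Nat.one_lt_two_pow hi).ne
  rw [hp] at hc
  simp at hc

/-- Additive Hilbert 90 for the absolute trace. -/
theorem exists_sq_add_self_eq {m : ℕ} (hF : Fintype.card F = 2 ^ m) {v : F}
    (hv : absTr m v = 0) : ∃ s : F, s ^ 2 + s = v := by
  have : CharP F 2 := charP_two_of_card hF
  let T : F →+ F := AddMonoidHom.mk' (absTr m) (absTr_add m)
  let P : F →+ F := AddMonoidHom.mk' (fun s => s ^ 2 + s) fun x y => by
    rw [CharTwo.add_sq]; ring
  have hle : P.range ≤ T.ker := by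
    rintro _ ⟨s, rfl⟩
    change absTr m (s ^ 2 + s) = 0
    rw [absTr_add, absTr_pow_two hF, CharTwo.add_self_eq_zero]
  have hPker : Nat.card P.ker ≤ 2 := by
    have h : (P.ker : Set F) ⊆ ({0, 1} : Finset F) := by
      intro s hs
      have hs' : s ^ 2 + s = 0 := hs
      have h0 : s * (s + 1) = 0 := by linear_combination hs'
      rcases mul_eq_zero.1 h0 with h0 | h0
      · simp [h0]
      · simp [CharTwo.add_eq_zero.1 h0]
    have h1 := Set.ncard_le_ncard h (Finset.finite_toSet _)
    rw [Set.ncard_coe_finset] at h1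
    exact h1.trans Finset.card_le_two
  have hTrange : 2 ≤ Nat.card T.range := by
    obtain ⟨e, he⟩ := exists_absTr_eq_one hF
    have : Nontrivial T.range := ⟨⟨⟨T e, e, rfl⟩, 0, fun h => by
      have h' : absTr m e = 0 := congrArg Subtype.val h
      rw [he] at h'
      exact one_ne_zero h'⟩⟩
    exact Finite.one_lt_card
  have hP := AddSubgroup.card_mul_index P.ker
  have hT := AddSubgroup.card_mul_index T.ker
  rw [AddSubgroup.index_ker] at hP hT
  have hpos : 0 < Nat.card P.range := Nat.card_pos
  have hcard : Nat.card T.ker ≤ Nat.card P.range := by nlinarith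
  have heq : P.range = T.ker := AddSubgroup.eq_of_le_of_card_ge hle hcard
  have hmem : v ∈ P.range := heq ▸ hv
  exact hmem

theorem sgn_absTr_add {m : ℕ} (hF : Fintype.card F = 2 ^ m) (x y : F) :
    sgn (absTr m (x + y)) = sgn (absTr m x) * sgn (absTr m y) := by
  have : CharP F 2 := charP_two_of_card hF
  rw [absTr_add]
  rcases absTr_eq_zero_or_one hF x with h | h <;>
    rcases absTr_eq_zero_or_one hF y with h' | h' <;>
    simp [h, h', sgn, CharTwo.add_self_eq_zero]

theorem sum_sgn_absTr_mul {m : ℕ} (hF : Fintype.card F = 2 ^ m) {c : F} (hc : c ≠ 0) :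
    ∑ z : F, sgn (absTr m (c * z)) = 0 := by
  obtain ⟨e, he⟩ := exists_absTr_eq_one hF
  have h := Equiv.sum_comp (Equiv.addRight (c⁻¹ * e)) fun z => sgn (absTr m (c * z))
  have h' : ∀ z, sgn (absTr m (c * (z + c⁻¹ * e))) = -sgn (absTr m (c * z)) := fun z => by
    rw [mul_add, mul_inv_cancel_left₀ hc, sgn_absTr_add hF, he]
    simp [sgn]
  simp only [Equiv.coe_addRight, h', Finset.sum_neg_distrib] at h
  omega

theorem card_sq_add_self_eq {m : ℕ} (hF : Fintype.card F = 2 ^ m) (v : F) :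
    ((Finset.univ.filter fun s : F => s ^ 2 + s = v).card : ℤ) = 1 + sgn (absTr m v) := by
  have : CharP F 2 := charP_two_of_card hF
  rcases absTr_eq_zero_or_one hF v with hv | hv
  · obtain ⟨s, hs⟩ := exists_sq_add_self_eq hF hv
    have : (Finset.univ.filter fun t : F => t ^ 2 + t = v) = {s, s + 1} := by
      ext t
      simp only [Finset.mem_filter, Finset.mem_univ, true_and, Finset.mem_insert,
        Finset.mem_singleton]
      constructor
      · intro ht
        have h0 : (t - s) * (t - (s + 1)) = 0 := by
          linear_combination ht - hs - (t * s + t - s ^ 2 - s) * CharTwo.two_eq_zero (R := F)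
        rcases mul_eq_zero.1 h0 with h0 | h0
        · exact Or.inl (sub_eq_zero.1 h0)
        · exact Or.inr (sub_eq_zero.1 h0)
      · rintro (rfl | rfl)
        · exact hs
        · linear_combination hs + (s + 1) * CharTwo.two_eq_zero (R := F)
    rw [this, Finset.card_pair (by simp), hv]
    simp [sgn]
  · rw [Finset.filter_eq_empty_iff.2, hv]
    · simp [sgn]
    · rintro s - rfl
      rw [absTr_add, absTr_pow_two hF, CharTwo.add_self_eq_zero] at hv
      exact zero_ne_one hv

theorem card_add_inv_eq {m : ℕ} (hF : Fintype.card F = 2 ^ m) (z : F) :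
    ((Finset.univ.filter fun y : F => y ≠ 0 ∧ y + y⁻¹ = z).card : ℤ)
      = 1 + sgn (absTr m z⁻¹) - if z = 0 then 1 else 0 := by
  have : CharP F 2 := charP_two_of_card hF
  by_cases hz : z = 0
  · subst hz
    have : (Finset.univ.filter fun y : F => y ≠ 0 ∧ y + y⁻¹ = 0) = {1} := by
      ext y
      simp only [Finset.mem_filter, Finset.mem_univ, true_and, Finset.mem_singleton]
      constructor
      · rintro ⟨hy, h⟩
        have h1 : y * y = 1 := by
          rw [CharTwo.add_eq_zero] at h
          nth_rewrite 1 [h]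
          exact inv_mul_cancel₀ hy
        have h2 : (y - 1) * (y - 1) = 0 := by
          linear_combination h1 + (1 - y) * CharTwo.two_eq_zero (R := F)
        exact sub_eq_zero.1 (mul_self_eq_zero.1 h2)
      · rintro rfl
        simp [CharTwo.add_self_eq_zero]
    rw [this]
    simp [absTr, sgn]
  · rw [if_neg hz, sub_zero, ← absTr_pow_two hF z⁻¹, ← card_sq_add_self_eq hF]
    norm_cast
    refine Finset.card_bij' (fun y _ => z⁻¹ * y) (fun s _ => z * s) ?_ ?_ ?_ ?_
    · simp only [Finset.mem_filter, Finset.mem_univ, true_and]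
      rintro y ⟨hy, h⟩
      have h1 : y ^ 2 + 1 = z * y := by rw [← h]; field_simp
      field_simp
      linear_combination h1 + (z * y - 1) * CharTwo.two_eq_zero (R := F)
    · simp only [Finset.mem_filter, Finset.mem_univ, true_and]
      intro s h
      have hs : s ≠ 0 := by
        rintro rfl
        exact pow_ne_zero 2 (inv_ne_zero hz) (by rw [← h]; ring)
      refine ⟨mul_ne_zero hz hs, ?_⟩
      have h1 : z ^ 2 * (s ^ 2 + s) = 1 := by rw [h]; field_simp
      field_simp
      linear_combination h1 + (1 - z ^ 2 * s) * CharTwo.two_eq_zero (R := F)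
    · intro y _
      exact mul_inv_cancel_left₀ hz y
    · intro s _
      exact inv_mul_cancel_left₀ hz s

theorem sum_add_inv {m : ℕ} (hF : Fintype.card F = 2 ^ m) (f : F → ℤ) :
    ∑ y ∈ Finset.univ.filter (fun y : F => y ≠ 0), f (y + y⁻¹)
      = ∑ z : F, (1 + sgn (absTr m z⁻¹)) * f z - f 0 := by
  rw [← Finset.sum_fiberwise _ (fun y : F => y + y⁻¹)]
  have h : ∀ z : F, ∑ y ∈ Finset.univ.filter (fun y : F => y ≠ 0) with y + y⁻¹ = z, f (y + y⁻¹)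
      = (1 + sgn (absTr m z⁻¹)) * f z - if z = 0 then f z else 0 := fun z => by
    rw [Finset.sum_congr rfl fun y hy => by rw [(Finset.mem_filter.1 hy).2], Finset.sum_const,
      Finset.filter_filter, nsmul_eq_mul, card_add_inv_eq hF z]
    split_ifs <;> ring
  simp only [h, Finset.sum_sub_distrib, Finset.sum_ite_eq', Finset.mem_univ, if_true]

/-- The Dickson polynomial `z³ + z` permutes the elements whose inverse has trace one. -/
theorem sum_dickson_three {m : ℕ} (hm : Even m) (hF : Fintype.card F = 2 ^ m) (f : F → ℤ) :
    ∑ z ∈ Finset.univ.filter (fun z : F => absTr m z⁻¹ = 1), f (z ^ 3 + z)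
      = ∑ z ∈ Finset.univ.filter (fun z : F => absTr m z⁻¹ = 1), f z := by
  have : CharP F 2 := charP_two_of_card hF
  have hne : ∀ z : F, absTr m z⁻¹ = 1 → z ≠ 0 ∧ z + 1 ≠ 0 := by
    refine fun z hz => ⟨?_, fun h => ?_⟩
    · rintro rfl
      simp [absTr] at hz
    · rw [CharTwo.add_eq_zero.1 h, inv_one, absTr_one_of_even hm] at hz
      exact zero_ne_one hz
  have hinj : Set.InjOn (fun z : F => z ^ 3 + z)
      (Finset.univ.filter fun z : F => absTr m z⁻¹ = 1 : Finset F) := by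
    intro z hz w _ h
    have hz' : absTr m z⁻¹ = 1 := by simpa using hz
    have hz0 := (hne z hz').1
    by_contra hzw
    have h0 : (z - w) * (z ^ 2 + z * w + w ^ 2 + 1) = 0 := by
      simp only at h
      linear_combination h
    have h1 := (mul_eq_zero.1 h0).resolve_left (sub_ne_zero.2 hzw)
    have h2 : 1 + (z⁻¹) ^ 2 = (w * z⁻¹) ^ 2 + w * z⁻¹ := by
      field_simp
      linear_combination h1 - (w ^ 2 + z * w) * CharTwo.two_eq_zero (R := F)
    have h3 := congrArg (absTr m) h2
    rw [absTr_add, absTr_add, absTr_pow_two hF, absTr_pow_two hF, absTr_one_of_even hm, hz',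
      CharTwo.add_self_eq_zero, zero_add] at h3
    exact one_ne_zero h3
  have himg : (Finset.univ.filter fun z : F => absTr m z⁻¹ = 1).image (fun z : F => z ^ 3 + z)
      = Finset.univ.filter fun z : F => absTr m z⁻¹ = 1 := by
    refine Finset.eq_of_subset_of_card_le ?_ (Finset.card_image_of_injOn hinj).ge
    intro w hw
    obtain ⟨z, hz, rfl⟩ := Finset.mem_image.1 hw
    have hz' : absTr m z⁻¹ = 1 := by simpa using hz
    obtain ⟨hz0, hz1⟩ := hne z hz'
    have h : (z ^ 3 + z)⁻¹ = z⁻¹ + (((z + 1)⁻¹) ^ 2 + (z + 1)⁻¹) := by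
      have hd : z ^ 3 + z = z * (z + 1) ^ 2 := by
        linear_combination -z ^ 2 * CharTwo.two_eq_zero (R := F)
      rw [hd]
      field_simp
      linear_combination -(z ^ 2 + 2 * z) * CharTwo.two_eq_zero (R := F)
    simp only [Finset.mem_filter, Finset.mem_univ, true_and]
    rw [h, absTr_add, absTr_add, absTr_pow_two hF, CharTwo.add_self_eq_zero, add_zero, hz']
  conv_rhs => rw [← himg, Finset.sum_image hinj]

theorem two_mul_sum_absTr_inv_eq_one {m : ℕ} (hF : Fintype.card F = 2 ^ m) (f : F → ℤ) :
    2 * ∑ z ∈ Finset.univ.filter (fun z : F => absTr m z⁻¹ = 1), f z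
      = ∑ z : F, f z - ∑ z : F, sgn (absTr m z⁻¹) * f z := by
  rw [Finset.sum_filter, Finset.mul_sum, ← Finset.sum_sub_distrib]
  refine Finset.sum_congr rfl fun z _ => ?_
  rcases absTr_eq_zero_or_one hF z⁻¹ with h | h <;> simp [h, sgn]
  ring

theorem sum_cube_add_inv_cube {m : ℕ} (hm : Even m) (hF : Fintype.card F = 2 ^ m) {c : F}
    (hc : c ≠ 0) :
    ∑ y ∈ Finset.univ.filter (fun y : F => y ≠ 0), sgn (absTr m (c * (y ^ 3 + (y ^ 3)⁻¹)))
      = 2 * ∑ z : F, sgn (absTr m (c * (z ^ 3 + z)))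
        + ∑ z : F, sgn (absTr m (c * z + z⁻¹)) - 1 := by
  have : CharP F 2 := charP_two_of_card hF
  have h1 := sum_add_inv hF fun z => sgn (absTr m (c * (z ^ 3 + z)))
  have h2 := sum_dickson_three hm hF fun z => sgn (absTr m (c * z))
  have h3 := two_mul_sum_absTr_inv_eq_one hF fun z => sgn (absTr m (c * (z ^ 3 + z)))
  have h4 := two_mul_sum_absTr_inv_eq_one hF fun z => sgn (absTr m (c * z))
  rw [sum_sgn_absTr_mul hF hc] at h4
  have h5 : ∑ z : F, sgn (absTr m (c * z + z⁻¹))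
      = ∑ z : F, sgn (absTr m z⁻¹) * sgn (absTr m (c * z)) :=
    Finset.sum_congr rfl fun z _ => by rw [sgn_absTr_add hF, mul_comm]
  have h6 : sgn (absTr m (c * ((0 : F) ^ 3 + 0))) = 1 := by simp [absTr, sgn]
  have h7 : ∑ y ∈ Finset.univ.filter (fun y : F => y ≠ 0),
        sgn (absTr m (c * (y ^ 3 + (y ^ 3)⁻¹)))
      = ∑ y ∈ Finset.univ.filter (fun y : F => y ≠ 0),
        sgn (absTr m (c * ((y + y⁻¹) ^ 3 + (y + y⁻¹)))) := by
    refine Finset.sum_congr rfl fun y hy => ?_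
    have hy : y ≠ 0 := by simpa using hy
    congr 3
    field_simp
    linear_combination -(2 * y ^ 4 + 2 * y ^ 2) * CharTwo.two_eq_zero (R := F)
  simp only [add_mul, one_mul, Finset.sum_add_distrib, h6] at h1
  linarith

end TraceSign

section CubicCharacter

variable {F : Type*} [Field F]

theorem chi_mul (m : ℕ) (x y : F) : chi m (x * y) = chi m x * chi m y := mul_pow x y _

theorem chi_inv (m : ℕ) (x : F) : chi m x⁻¹ = (chi m x)⁻¹ := inv_pow x _

theorem eq_or_eq_or_eq_of_pow_three_eq_one [CharP F 2] {α γ δ : F} (hα : α ^ 3 = 1)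
    (hγ : γ ^ 3 = 1) (hδ : δ ^ 3 = 1) (hne : γ ≠ α) :
    (α * γ)⁻¹ = α + γ ∧ (δ = α ∨ δ = γ ∨ δ = α + γ) := by
  have h2 := CharTwo.two_eq_zero (R := F)
  have hq : ∀ u v : F, u ^ 3 = 1 → v ^ 3 = 1 → u ≠ v → u ^ 2 + u * v + v ^ 2 = 0 := by
    intro u v hu hv huv
    have h0 : (u - v) * (u ^ 2 + u * v + v ^ 2) = 0 := by linear_combination hu - hv
    exact (mul_eq_zero.1 h0).resolve_left (sub_ne_zero.2 huv)
  have hγα := hq γ α hγ hα hne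
  refine ⟨inv_eq_of_mul_eq_one_right ?_, ?_⟩
  · linear_combination α * hγα - hα - h2
  · by_cases h1 : δ = α
    · exact Or.inl h1
    by_cases h3 : δ = γ
    · exact Or.inr (Or.inl h3)
    have h4 := hq δ α hδ hα h1
    have h5 := hq δ γ hδ hγ h3
    have h6 : (α - γ) * (δ + (α + γ)) = 0 := by linear_combination h4 - h5
    exact Or.inr (Or.inr (CharTwo.add_eq_zero.1
      ((mul_eq_zero.1 h6).resolve_left (sub_ne_zero.2 (Ne.symm hne)))))

variable [Fintype F]

theorem chi_pow_three {m : ℕ} (hm : Even m) (hF : Fintype.card F = 2 ^ m) {x : F}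
    (hx : x ≠ 0) : chi m x ^ 3 = 1 := by
  have h3 : 3 ∣ 2 ^ m - 1 := by
    obtain ⟨k, rfl⟩ := hm.two_dvd
    simpa [pow_mul] using Nat.sub_one_dvd_pow_sub_one 4 k
  rw [chi, ← pow_mul, Nat.div_mul_cancel h3, ← hF]
  exact FiniteField.pow_card_sub_one_eq_one x hx

theorem three_mul_sum_chi_eq_one {m : ℕ} (hm : Even m) (hF : Fintype.card F = 2 ^ m)
    (f : F → ℤ) :
    3 * ∑ t ∈ Finset.univ.filter (fun t : F => t ≠ 0 ∧ chi m t = 1), f t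
      = ∑ y ∈ Finset.univ.filter (fun y : F => y ≠ 0), f (y ^ 3) := by
  have h3 : 3 ∣ 2 ^ m - 1 := by
    obtain ⟨k, rfl⟩ := hm.two_dvd
    simpa [pow_mul] using Nat.sub_one_dvd_pow_sub_one 4 k
  obtain ⟨d, hd⟩ := h3
  have hchi : ∀ x : F, chi m x = x ^ d := fun x => by simp [chi, hd]
  have hcard : Nat.card Fˣ = 3 * d := by rw [Nat.card_units, Nat.card_eq_fintype_card, hF, hd]
  have hd0 : 0 < d := by
    have : 0 < Nat.card Fˣ := Nat.card_pos
    omega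
  obtain ⟨g, hg⟩ := IsCyclic.exists_generator (α := Fˣ)
  have hord : orderOf g = 3 * d := by rw [orderOf_eq_card_of_forall_mem_zpowers hg, hcard]
  have hω : IsPrimitiveRoot ((g ^ d : Fˣ) : F) 3 := by
    have h := (IsPrimitiveRoot.orderOf g).pow (hord ▸ by omega) (hord.trans (mul_comm 3 d))
    exact IsPrimitiveRoot.coe_units_iff.2 h
  rw [← Finset.sum_fiberwise_of_maps_to (s := Finset.univ.filter fun y : F => y ≠ 0)
    (t := Finset.univ.filter (fun t : F => t ≠ 0 ∧ chi m t = 1)) (g := fun y : F => y ^ 3),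
    Finset.mul_sum]
  · refine Finset.sum_congr rfl fun t ht => ?_
    simp only [Finset.mem_filter, Finset.mem_univ, true_and, hchi] at ht
    obtain ⟨ht0, ht1⟩ := ht
    obtain ⟨y, hy⟩ : ∃ y : F, y ^ 3 = t := by
      obtain ⟨k, hk⟩ := (mem_powers_iff_mem_zpowers.2 (hg (Units.mk0 t ht0)))
      have hk : g ^ k = Units.mk0 t ht0 := hk
      have h1 : g ^ (k * d) = 1 := by
        rw [pow_mul, hk]
        exact Units.ext ht1
      have h2 := orderOf_dvd_of_pow_eq_one h1
      rw [hord] at h2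
      obtain ⟨j, rfl⟩ := Nat.dvd_of_mul_dvd_mul_right hd0 h2
      refine ⟨(g ^ j : Fˣ), ?_⟩
      rw [← Units.val_pow_eq_pow_val, ← pow_mul, mul_comm, hk, Units.val_mk0]
    have hy0 : y ≠ 0 := by
      rintro rfl
      exact ht0 (by simp [← hy])
    have hfib : (Finset.univ.filter (fun y : F => y ≠ 0)).filter (fun x => x ^ 3 = t)
        = (Polynomial.nthRootsFinset 3 (1 : F)).image (y * ·) := by
      ext x
      simp only [Finset.mem_filter, Finset.mem_univ, true_and, Finset.mem_image,
        Polynomial.mem_nthRootsFinset three_pos]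
      constructor
      · rintro ⟨-, hx⟩
        refine ⟨y⁻¹ * x, ?_, mul_inv_cancel_left₀ hy0 x⟩
        rw [mul_pow, hx, inv_pow, hy, inv_mul_cancel₀ ht0]
      · rintro ⟨w, hw, rfl⟩
        have hw0 : w ≠ 0 := by
          rintro rfl
          simp at hw
        exact ⟨mul_ne_zero hy0 hw0, by rw [mul_pow, hw, hy, mul_one]⟩
    rw [Finset.sum_congr rfl fun x hx => by rw [(Finset.mem_filter.1 hx).2], Finset.sum_const,
      hfib, Finset.card_image_of_injective _ (mul_right_injective₀ hy0), hω.card_nthRootsFinset]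
    simp
  · intro y hy
    have hy : y ≠ 0 := by simpa using hy
    simp only [Finset.mem_filter, Finset.mem_univ, true_and]
    refine ⟨pow_ne_zero 3 hy, ?_⟩
    rw [← chi_pow_three hm hF hy, chi, chi, ← pow_mul, ← pow_mul, mul_comm]

theorem gf_eq_univ {m : ℕ} (hF : Fintype.card F = 2 ^ m) : gf F m = Finset.univ := by
  ext x
  simpa [gf] using hF ▸ FiniteField.pow_card x

theorem sum_absTr_sq {m : ℕ} (hF : Fintype.card F = 2 ^ m) (f g : F → F)
    (h : ∀ x, f (x ^ 2) = g x ^ 2) :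
    ∑ x : F, sgn (absTr m (f x)) = ∑ x : F, sgn (absTr m (g x)) := by
  have : CharP F 2 := charP_two_of_card hF
  rw [← Equiv.sum_comp (Equiv.ofBijective _ (bijective_frobenius F 2))]
  exact Finset.sum_congr rfl fun x _ => by
    rw [Equiv.ofBijective_apply, frobenius_def, h, absTr_pow_two hF]

/-- The twisted sum over the coset of `a` reduces to a full cubic sum. -/
theorem three_mul_sum_chi_eq_chi {m : ℕ} (hm : Even m) (hF : Fintype.card F = 2 ^ m) {a : F}
    (ha : a ≠ 0) :
    3 * ∑ x ∈ Finset.univ.filter (fun x : F => x ≠ 0 ∧ chi m x = chi m a),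
          sgn (absTr m (a * x + x⁻¹))
      = 2 * cub m a a + kloo m a - 1 := by
  have : CharP F 2 := charP_two_of_card hF
  obtain ⟨c, hc⟩ := (bijective_frobenius F 2).2 a
  rw [frobenius_def] at hc
  subst hc
  have hc0 : c ≠ 0 := by
    rintro rfl
    simp at ha
  have hχ : chi m (c ^ 2) * chi m c = 1 := by
    rw [← chi_mul, ← pow_succ, ← chi_pow_three hm hF hc0, chi, chi, ← pow_mul, ← pow_mul,
      mul_comm]
  have hre : ∑ x ∈ Finset.univ.filter (fun x : F => x ≠ 0 ∧ chi m x = chi m (c ^ 2)),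
        sgn (absTr m (c ^ 2 * x + x⁻¹))
      = ∑ t ∈ Finset.univ.filter (fun t : F => t ≠ 0 ∧ chi m t = 1),
        sgn (absTr m (c * (t + t⁻¹))) := by
    refine Finset.sum_bij' (fun x _ => c * x) (fun t _ => c⁻¹ * t) ?_ ?_ ?_ ?_ ?_
    · simp only [Finset.mem_filter, Finset.mem_univ, true_and]
      rintro x ⟨hx, h⟩
      exact ⟨mul_ne_zero hc0 hx, by rw [chi_mul, h, mul_comm, hχ]⟩
    · simp only [Finset.mem_filter, Finset.mem_univ, true_and]
      rintro t ⟨ht, h⟩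
      exact ⟨mul_ne_zero (inv_ne_zero hc0) ht, by
        rw [chi_mul, h, mul_one, chi_inv, eq_comm, eq_inv_of_mul_eq_one_left hχ]⟩
    · intro x _
      exact inv_mul_cancel_left₀ hc0 x
    · intro t _
      exact mul_inv_cancel_left₀ hc0 t
    · intro x _
      congr 2
      rw [mul_inv, mul_add, mul_inv_cancel_left₀ hc0]
      ring
  rw [hre, three_mul_sum_chi_eq_one hm hF fun t => sgn (absTr m (c * (t + t⁻¹))),
    sum_cube_add_inv_cube hm hF hc0, cub, kloo, gf_eq_univ hF,
    sum_absTr_sq hF (fun x => c ^ 2 * x ^ 3 + c ^ 2 * x) (fun x => c * (x ^ 3 + x)) fun x => by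
      simp only [mul_pow, CharTwo.add_sq]; ring,
    sum_absTr_sq hF (fun x => c ^ 2 * x + x⁻¹) (fun x => c * x + x⁻¹) fun x => by
      simp only [mul_pow, CharTwo.add_sq, inv_pow]]

theorem sum_chi_inv_mul {m : ℕ} {a : F} (ha : a ≠ 0) (γ : F) :
    ∑ x ∈ Finset.univ.filter (fun x : F => x ≠ 0 ∧ chi m x = γ),
        sgn (absTr m (a * x + x⁻¹))
      = ∑ x ∈ Finset.univ.filter (fun x : F => x ≠ 0 ∧ chi m x = (chi m a * γ)⁻¹),
        sgn (absTr m (a * x + x⁻¹)) := by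
  refine Finset.sum_bij' (fun x _ => (a * x)⁻¹) (fun x _ => (a * x)⁻¹) ?_ ?_ ?_ ?_ ?_
  · simp only [Finset.mem_filter, Finset.mem_univ, true_and]
    rintro x ⟨hx, h⟩
    exact ⟨inv_ne_zero (mul_ne_zero ha hx), by rw [chi_inv, chi_mul, h]⟩
  · simp only [Finset.mem_filter, Finset.mem_univ, true_and]
    rintro x ⟨hx, h⟩
    have hα : chi m a ≠ 0 := pow_ne_zero _ ha
    exact ⟨inv_ne_zero (mul_ne_zero ha hx), by
      rw [chi_inv, chi_mul, h, mul_inv, inv_inv, inv_mul_cancel_left₀ hα]⟩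
  · intro x _
    rw [mul_inv, mul_inv, mul_inv, inv_inv, inv_inv, inv_mul_cancel_left₀ ha]
  · intro x _
    rw [mul_inv, mul_inv, mul_inv, inv_inv, inv_inv, inv_mul_cancel_left₀ ha]
  · intro x _
    congr 2
    rw [inv_inv, mul_inv, mul_inv_cancel_left₀ ha, add_comm]

theorem sum_chi_add_sum_chi {m : ℕ} (hm : Even m) (hF : Fintype.card F = 2 ^ m) {a γ : F}
    (ha : a ≠ 0) (hγ : γ ^ 3 = 1) (hne : γ ≠ chi m a) :
    ∑ x ∈ Finset.univ.filter (fun x : F => x ≠ 0 ∧ chi m x = chi m a),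
        sgn (absTr m (a * x + x⁻¹))
      + 2 * ∑ x ∈ Finset.univ.filter (fun x : F => x ≠ 0 ∧ chi m x = γ),
        sgn (absTr m (a * x + x⁻¹))
      = kloo m a - 1 := by
  have : CharP F 2 := charP_two_of_card hF
  have hα := chi_pow_three hm hF ha
  have hsym := sum_chi_inv_mul (m := m) ha γ
  rw [(eq_or_eq_or_eq_of_pow_three_eq_one hα hγ hγ hne).1] at hsym
  have hα0 : chi m a ≠ 0 := pow_ne_zero _ ha
  have hγ0 : γ ≠ 0 := by
    rintro rfl
    simp at hγ
  rw [two_mul]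
  nth_rewrite 2 [hsym]
  rw [kloo, gf_eq_univ hF, ← Finset.add_sum_erase _ _ (Finset.mem_univ (0 : F))]
  have h0 : sgn (absTr m (a * 0 + (0 : F)⁻¹)) = 1 := by simp [absTr, sgn]
  rw [h0, add_sub_cancel_left, ← Finset.filter_ne' Finset.univ (0 : F)]
  simp only [Finset.sum_filter, ← Finset.sum_add_distrib]
  refine Finset.sum_congr rfl fun x _ => ?_
  by_cases hx : x = 0
  · simp [hx]
  rcases (eq_or_eq_or_eq_of_pow_three_eq_one hα hγ (chi_pow_three hm hF hx) hne).2 with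
    h | h | h
  · simp [h, hx, hne.symm, hγ0]
  · simp [h, hx, hne, hα0]
  · simp [h, hx, hα0, hγ0]

end CubicCharacter

/-- For `m₁ = 2·m₂` with `m₂` odd, `a ∈ F_{2^{m₁}}^*`, `γ ∈ F_4^*` and `α = χ_{m₁}(a)`:
`3 · ∑_{x ∈ F_{2^{m₁}}^*, χ_{m₁}(x) = γ} (−1)^{Tr^{m₁}(a·x + x⁻¹)}
  = 2·C_{m₁}(a,a) + K_{m₁}(a) − 1` if `γ = α`, and `= −C_{m₁}(a,a) + K_{m₁}(a) − 1`
if `γ ≠ α`. (The ambient field is `F_{2^{m₁}}` itself.) -/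
theorem twisted_kloosterman_sum
    {F : Type*} [Field F] [Fintype F]
    (m1 m2 : ℕ) (hm2 : Odd m2) (hm1 : m1 = 2 * m2)
    (hF : Fintype.card F = 2 ^ m1)
    (a γ : F) (ha : a ≠ 0) (hγ : γ ^ 3 = 1) (hγ0 : γ ≠ 0) :
    (γ = chi m1 a →
      3 * ∑ x ∈ Finset.univ.filter (fun x : F => x ≠ 0 ∧ chi m1 x = γ),
            sgn (absTr m1 (a * x + x⁻¹))
        = 2 * cub m1 a a + kloo m1 a - 1) ∧
    (γ ≠ chi m1 a →
      3 * ∑ x ∈ Finset.univ.filter (fun x : F => x ≠ 0 ∧ chi m1 x = γ),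
            sgn (absTr m1 (a * x + x⁻¹))
        = -cub m1 a a + kloo m1 a - 1) := by
  have hm : Even m1 := hm1 ▸ even_two_mul m2
  have hα := three_mul_sum_chi_eq_chi hm hF ha
  refine ⟨fun h => h ▸ hα, fun h => ?_⟩
  have hsum := sum_chi_add_sum_chi hm hF ha hγ h
  linarith
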